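/- arXiv:2305.07234 — 4 statements merged into one kernel-verified Lean document; each statement's English description precedes it below -/
import Mathlib

section
/- Let N ≥ 3 be an odd integer and p an integer with 1 ≤ p < N and gcd(p, N) = 1. Then the Zadoff–Chu sequence s of length N with root index p has perfect periodic autocorrelation: for all integers τ and n, the circular correlation Σ_{i=0}^{N−1} s[i−τ]·conj(s[i−n]) equals N if n ≡ τ (mod N), and equals 0 otherwise. -/
/-- The Zadoff–Chu sequence of length `N` with root index `p`:
`s[n] = exp(-i π p n (n+1) / N)`, defined for every integer `n`. -/
noncomputable def zcSeq (N : ℕ) (p : ℤ) (n : ℤ) : ℂ :=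
  Complex.exp (-(Real.pi : ℂ) * Complex.I * (p : ℂ) * (n : ℂ) * ((n : ℂ) + 1) / (N : ℂ))

open Complex in
lemma zcSeq_mul_conj (N : ℕ) (p τ n : ℤ) (i : ℕ) :
    zcSeq N p ((i : ℤ) - τ) * (starRingEnd ℂ) (zcSeq N p ((i : ℤ) - n)) =
      exp (Real.pi * I * p * (n - τ) * (τ + n - 1) / N) *
        exp (-(p * (n - τ) : ℤ) / N * (2 * Real.pi * I)) ^ i := by
  unfold zcSeq
  rw [← exp_conj, ← exp_add, ← exp_nat_mul, ← exp_add]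
  congr 1
  simp only [map_div₀, map_mul, map_neg, map_add, map_one, conj_ofReal, conj_I, map_intCast,
    map_natCast]
  push_cast
  ring

open Complex in
lemma exp_neg_div_mul_two_pi_I_eq_one_iff {N : ℕ} (hN : N ≠ 0) (a : ℤ) :
    exp (-(a : ℂ) / N * (2 * Real.pi * I)) = 1 ↔ (N : ℤ) ∣ a := by
  have hNC : (N : ℂ) ≠ 0 := Nat.cast_ne_zero.mpr hN
  rw [exp_eq_one_iff, ← dvd_neg]
  refine exists_congr fun k => ?_
  rw [mul_left_inj' two_pi_I_ne_zero, div_eq_iff hNC, mul_comm (k : ℂ)]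
  exact_mod_cast Iff.rfl

open Complex in
lemma exp_neg_div_mul_two_pi_I_pow_eq_one {N : ℕ} (hN : N ≠ 0) (a : ℤ) :
    exp (-(a : ℂ) / N * (2 * Real.pi * I)) ^ N = 1 := by
  have hNC : (N : ℂ) ≠ 0 := Nat.cast_ne_zero.mpr hN
  rw [← exp_nat_mul, exp_eq_one_iff]
  refine ⟨-a, ?_⟩
  push_cast
  field_simp

open Complex in
lemma exp_pi_mul_sub_mul_add_sub_one_eq_one {N : ℕ} (hNodd : Odd N) (p : ℤ) {τ n : ℤ}
    (h : (N : ℤ) ∣ n - τ) :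
    exp (Real.pi * I * p * (n - τ) * (τ + n - 1) / N) = 1 := by
  have hNC : (N : ℂ) ≠ 0 := Nat.cast_ne_zero.mpr hNodd.pos.ne'
  obtain ⟨k, hk⟩ := h
  have hkC : (n : ℂ) - τ = N * k := by exact_mod_cast hk
  have heven : Even (k * (τ + n - 1)) := by
    obtain rfl : n = N * k + τ := by linarith
    have : Odd (N : ℤ) := by exact_mod_cast hNodd
    grind [Int.even_add, Int.even_sub, Int.not_even_iff_odd, Int.not_even_one]
  obtain ⟨m, hm⟩ := heven
  have hmC : (k : ℂ) * (τ + n - 1) = m + m := by exact_mod_cast hm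
  rw [exp_eq_one_iff]
  refine ⟨p * m, ?_⟩
  rw [hkC, div_eq_iff hNC]
  push_cast
  linear_combination (Real.pi * I * p * N : ℂ) * hmC

/-- For odd `N ≥ 3` and root index `p` with `1 ≤ p < N`, `gcd(p, N) = 1`, the Zadoff–Chu
sequence has perfect periodic autocorrelation: the circular correlation
`Σ_{i=0}^{N-1} s[i-τ] conj(s[i-n])` equals `N` if `n ≡ τ (mod N)` and `0` otherwise. -/
theorem zc_perfect_autocorrelation
    (N : ℕ) (hN3 : 3 ≤ N) (hNodd : Odd N)
    (p : ℤ) (hp1 : 1 ≤ p) (hpN : p < (N : ℤ)) (hgcd : Int.gcd p (N : ℤ) = 1)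
    (τ n : ℤ) :
    ∑ i ∈ Finset.range N, zcSeq N p ((i : ℤ) - τ) * (starRingEnd ℂ) (zcSeq N p ((i : ℤ) - n)) =
      if (N : ℤ) ∣ (n - τ) then (N : ℂ) else 0 := by
  have hN : N ≠ 0 := hNodd.pos.ne'
  have hdvd : (N : ℤ) ∣ p * (n - τ) ↔ (N : ℤ) ∣ n - τ :=
    ⟨(Int.isCoprime_iff_gcd_eq_one.mpr hgcd).symm.dvd_of_dvd_mul_left, fun h => h.mul_left p⟩
  simp_rw [zcSeq_mul_conj]
  rw [← Finset.mul_sum]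
  split_ifs with h
  · rw [exp_pi_mul_sub_mul_add_sub_one_eq_one hNodd p h,
      (exp_neg_div_mul_two_pi_I_eq_one_iff hN _).mpr (hdvd.mpr h)]
    simp
  · rw [geom_sum_eq (mt (exp_neg_div_mul_two_pi_I_eq_one_iff hN _).mp (mt hdvd.mp h)),
      exp_neg_div_mul_two_pi_I_pow_eq_one hN]
    simp
end

section
/- Let N ≥ 3 be an odd integer, p an integer with 1 ≤ p ≤ (N−1)/2, A = ⌊(N−1)/(2p)⌋ and B = (N−1)/2 − A·p. Then: (i) for every integer k with 0 ≤ k ≤ A, the representative ⟨p·k⟩_N equals p·k, so |⟨p·k⟩_N| = k·p; and (ii) for every integer k with A+1 ≤ k ≤ 2A, one has |⟨p·k⟩_N| = (2A − k)·p + 2B + 1. -/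
/-- For odd `N ≥ 3` and `1 ≤ p ≤ (N−1)/2`, with `A = ⌊(N−1)/(2p)⌋` and
`B = (N−1)/2 − A·p`, the balanced residue `⟨p·k⟩_N` (the representative of `p·k`
modulo `N` in `[−(N−1)/2, (N−1)/2]`, i.e. `Int.bmod (p*k) N` for odd `N`) satisfies:
(i) for `0 ≤ k ≤ A`, `⟨p·k⟩_N = p·k` and hence `|⟨p·k⟩_N| = k·p`; and
(ii) for `A+1 ≤ k ≤ 2A`, `|⟨p·k⟩_N| = (2A − k)·p + 2B + 1`. -/
theorem zc_balanced_residue_table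
    (N : ℕ) (hN3 : 3 ≤ N) (hNodd : Odd N)
    (p : ℤ) (hp1 : 1 ≤ p) (hp2 : p ≤ ((N : ℤ) - 1) / 2)
    (A B : ℤ) (hA : A = ((N : ℤ) - 1) / (2 * p)) (hB : B = ((N : ℤ) - 1) / 2 - A * p) :
    (∀ k : ℤ, 0 ≤ k → k ≤ A →
        Int.bmod (p * k) N = p * k ∧ |Int.bmod (p * k) N| = k * p) ∧
    (∀ k : ℤ, A + 1 ≤ k → k ≤ 2 * A →
        |Int.bmod (p * k) N| = (2 * A - k) * p + 2 * B + 1) := by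
  obtain ⟨m, rfl⟩ := hNodd
  have hhalf : (((2 * m + 1 : ℕ) : ℤ) - 1) / 2 = m := by push_cast; omega
  rw [hhalf] at hp2 hB
  have hAm : A = (m : ℤ) / p := by
    rw [hA, ← Int.ediv_ediv_of_nonneg (by norm_num), hhalf]
  have hB_nonneg : 0 ≤ B := by
    have := Int.ediv_mul_le (m : ℤ) (show p ≠ 0 by omega)
    rw [← hAm] at this
    omega
  have hB_lt : B < p := by
    have := Int.lt_ediv_add_one_mul_self (m : ℤ) (show 0 < p by omega)
    rw [← hAm, add_mul] at this
    omega
  refine ⟨fun k hk0 hkA => ?_, fun k hkA hk2A => ?_⟩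
  · have h_nonneg : 0 ≤ p * k := by positivity
    have h_le : p * k ≤ A * p := by nlinarith
    have h_bmod : Int.bmod (p * k) (2 * m + 1) = p * k :=
      Int.bmod_eq_of_le (by push_cast; omega) (by push_cast; omega)
    exact ⟨h_bmod, by rw [h_bmod, abs_of_nonneg h_nonneg, mul_comm]⟩
  · have h_ge : A * p + p ≤ p * k := by nlinarith
    have h_le : p * k ≤ 2 * (A * p) := by nlinarith
    have h_bmod : Int.bmod (p * k) (2 * m + 1) = p * k - (2 * m + 1 : ℕ) := by
      rw [← Int.sub_bmod_right]
      exact Int.bmod_eq_of_le (by push_cast; omega) (by push_cast; omega)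
    rw [h_bmod, abs_of_neg (by push_cast; omega)]
    push_cast
    linear_combination -2 * hB
end

section
/- Let N ≥ 3 be an odd integer, p an integer with 1 ≤ p ≤ (N−1)/2, and A = ⌊(N−1)/(2p)⌋. Then for every integer k with 0 < |k| < 2A, the representative of p·k modulo N satisfies |⟨p·k⟩_N| ≥ p. -/
/-- For odd `N ≥ 3`, `1 ≤ p ≤ (N−1)/2` and `A = ⌊(N−1)/(2p)⌋`, every integer `k` with
`0 < |k| < 2A` satisfies `|⟨p·k⟩_N| ≥ p`, where `⟨x⟩_N` is the balanced representative
of `x` modulo `N` in `[−(N−1)/2, (N−1)/2]` (i.e. `Int.bmod x N` for odd `N`). -/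
theorem zc_balanced_residue_lower_bound
    (N : ℕ) (hN3 : 3 ≤ N) (hNodd : Odd N)
    (p : ℤ) (hp1 : 1 ≤ p) (hp2 : p ≤ ((N : ℤ) - 1) / 2)
    (A : ℤ) (hA : A = ((N : ℤ) - 1) / (2 * p)) :
    ∀ k : ℤ, 0 < |k| → |k| < 2 * A → p ≤ |Int.bmod (p * k) N| := by
  intro k hk0 hk
  by_contra! hlt
  obtain ⟨c, hc⟩ := Int.dvd_self_sub_bmod (x := p * k) (m := N)
  have hAp : A * (2 * p) ≤ (N : ℤ) - 1 := hA ▸ Int.ediv_mul_le _ (by positivity)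
  have hpk : |p * k| = p * |k| := by rw [abs_mul, abs_of_pos hp1]
  have hpk_le : p * |k| ≤ p * (2 * A - 1) :=
    mul_le_mul_of_nonneg_left (by lia) (by lia)
  have hNc : (N : ℤ) * |c| < N * 1 := by
    calc (N : ℤ) * |c| = |p * k - Int.bmod (p * k) N| := by rw [hc, abs_mul, Nat.abs_cast]
      _ ≤ |p * k| + |Int.bmod (p * k) N| := abs_sub _ _
      _ < N * 1 := by linarith
  have hc0 : c = 0 := Int.abs_lt_one_iff.mp (lt_of_mul_lt_mul_left hNc (by positivity))
  have hbmod : Int.bmod (p * k) N = p * k := by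
    rw [hc0, mul_zero, sub_eq_zero] at hc
    exact hc.symm
  rw [hbmod, hpk] at hlt
  exact hlt.not_ge (le_mul_of_one_le_right (by lia) hk0)
end

section
/- Let N ≥ 3 be an integer and p an integer with 1 ≤ p ≤ (N−1)/2. Then the function v ↦ sin((π/N)(p − vN)) / sin(πv) is strictly decreasing on the interval (0, 1/N). Hence, over all Doppler shifts v with 0 < v ≤ v̄ < 1/N, the guaranteed peak-to-sidelobe ratio sin((π/N)(p − vN))/sin(πv) is minimized at the maximum Doppler shift v = v̄. -/
open Real

theorem strictAntiOn_sin_sub_div_sin {a : ℝ} (ha : 0 < sin a) :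
    StrictAntiOn (fun x : ℝ => sin (a - x) / sin x) (Set.Ioo 0 π) := by
  intro x hx y hy hxy
  have hsub : 0 < sin (y - x) := sin_pos_of_pos_of_lt_pi (by linarith) (by linarith [hx.1, hy.2])
  have key : sin (a - x) * sin y - sin (a - y) * sin x = sin a * sin (y - x) := by
    simp only [sin_sub]
    ring
  change sin (a - y) / sin y < sin (a - x) / sin x
  rw [div_lt_div_iff₀ (sin_pos_of_mem_Ioo hy) (sin_pos_of_mem_Ioo hx)]
  linarith [mul_pos ha hsub]

/-- For an integer `N ≥ 3` and `1 ≤ p ≤ (N−1)/2`, the guaranteed PSLR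
`v ↦ sin((π/N)(p − vN)) / sin(πv)` is strictly decreasing on `(0, 1/N)`; hence over
all Doppler shifts `0 < v ≤ v̄ < 1/N` it is minimized at the maximum shift `v = v̄`. -/
theorem zc_pslr_strictAnti_in_doppler
    (N : ℕ) (hN3 : 3 ≤ N)
    (p : ℤ) (hp1 : 1 ≤ p) (hp2 : p ≤ ((N : ℤ) - 1) / 2) :
    StrictAntiOn
      (fun v : ℝ => Real.sin ((π / (N : ℝ)) * ((p : ℝ) - v * (N : ℝ))) / Real.sin (π * v))
      (Set.Ioo 0 (1 / (N : ℝ))) ∧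
    (∀ v vbar : ℝ, 0 < v → v ≤ vbar → vbar < 1 / (N : ℝ) →
      Real.sin ((π / (N : ℝ)) * ((p : ℝ) - vbar * (N : ℝ))) / Real.sin (π * vbar) ≤
        Real.sin ((π / (N : ℝ)) * ((p : ℝ) - v * (N : ℝ))) / Real.sin (π * v)) := by
  have hN : (3 : ℝ) ≤ N := by exact_mod_cast hN3
  have hN0 : (0 : ℝ) < N := by linarith
  have hp0 : (0 : ℝ) < p := by exact_mod_cast hp1
  have hpN : (p : ℝ) < N := by
    have : p < (N : ℤ) := by omega
    exact_mod_cast this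
  have ha : 0 < sin (π / N * p) := by
    apply sin_pos_of_pos_of_lt_pi (by positivity)
    rw [div_mul_eq_mul_div, div_lt_iff₀ hN0]
    exact mul_lt_mul_of_pos_left hpN pi_pos
  have harg (v : ℝ) : π / N * (p - v * N) = π / N * p - π * v := by
    field_simp
  have hmem (v : ℝ) (hv : v ∈ Set.Ioo 0 (1 / (N : ℝ))) : π * v ∈ Set.Ioo 0 π := by
    have hle : 1 / (N : ℝ) ≤ 1 := by
      rw [div_le_one hN0]
      linarith
    exact ⟨mul_pos pi_pos hv.1, mul_lt_of_lt_one_right pi_pos (hv.2.trans_le hle)⟩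
  have hanti : StrictAntiOn
      (fun v : ℝ => sin (π / (N : ℝ) * ((p : ℝ) - v * (N : ℝ))) / sin (π * v))
      (Set.Ioo 0 (1 / (N : ℝ))) := by
    intro v hv w hw hvw
    simp only [harg]
    exact strictAntiOn_sin_sub_div_sin ha (hmem v hv) (hmem w hw)
      (mul_lt_mul_of_pos_left hvw pi_pos)
  exact ⟨hanti, fun v vbar hv hle hlt =>
    hanti.antitoneOn ⟨hv, hle.trans_lt hlt⟩ ⟨hv.trans_le hle, hlt⟩ hle⟩
end
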